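/- Let H be a limit sparse numerical semigroup with even Frobenius number ℓ_g = 2g - 2r = 6r - 2 (so g = 4r - 1). Then 3 ∈ H if and only if 6r - 5 ∉ H. -/

import Mathlib

/-- `H` is a numerical semigroup of genus `g`: it contains `0`, is closed under
addition, and its complement in `ℕ` (the set of gaps) is finite with exactly
`g` elements. -/
def IsNumericalSemigroupOfGenus (H : Set ℕ) (g : ℕ) : Prop :=
  0 ∈ H ∧ (∀ a ∈ H, ∀ b ∈ H, a + b ∈ H) ∧ Hᶜ.Finite ∧ Hᶜ.ncard = g

/-- The `i`-th gap `ℓ_i` of `H` (1-indexed): the `i`-th smallest element of `ℕ \ H`.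
In particular, if `H` has genus `g`, then `gap H g` is the Frobenius number of `H`. -/
noncomputable def gap (H : Set ℕ) (i : ℕ) : ℕ :=
  Nat.nth (fun n => n ∉ H) (i - 1)

/-- A numerical semigroup `H` of genus `g` is sparse if any two subsequent gaps
differ by at most `2`. -/
def IsSparse (H : Set ℕ) (g : ℕ) : Prop :=
  ∀ i, 1 ≤ i → i ≤ g - 1 → gap H (i + 1) - gap H i ≤ 2

/-- `D`, the number of double leaps of `H` (of genus `g`). -/
noncomputable def numDouble (H : Set ℕ) (g : ℕ) : ℕ :=
  {i : ℕ | 1 ≤ i ∧ i ≤ g - 1 ∧ gap H (i + 1) - gap H i = 2}.ncard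

/-- `S`, the number of single leaps of `H` (of genus `g`). -/
noncomputable def numSingle (H : Set ℕ) (g : ℕ) : ℕ :=
  {i : ℕ | 1 ≤ i ∧ i ≤ g - 1 ∧ gap H (i + 1) - gap H i = 1}.ncard

open Classical in
/-- The number of gaps of `H` below its `i`-th gap is `i - 1`. -/
theorem count_gap {H : Set ℕ} {g i : ℕ} (hH : IsNumericalSemigroupOfGenus H g) (hi : 0 < i)
    (hig : i ≤ g) : Nat.count (fun n => n ∉ H) (gap H i) = i - 1 := by
  obtain ⟨-, -, -, hcard⟩ := hH
  refine Nat.count_nth fun hf => ?_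
  have h := Set.ncard_eq_toFinset_card _ hf
  change Hᶜ.ncard = _ at h
  omega

theorem gap_notMem {H : Set ℕ} {g i : ℕ} (hH : IsNumericalSemigroupOfGenus H g) (hi : 0 < i)
    (hig : i ≤ g) : gap H i ∉ H := by
  obtain ⟨-, -, -, hcard⟩ := hH
  refine Nat.nth_mem (p := fun n => n ∉ H) (i - 1) fun hf => ?_
  have h := Set.ncard_eq_toFinset_card _ hf
  change Hᶜ.ncard = _ at h
  omega

theorem nsmul_mem_of_genus {H : Set ℕ} {g a : ℕ} (hH : IsNumericalSemigroupOfGenus H g)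
    (ha : a ∈ H) (k : ℕ) : k * a ∈ H := by
  induction k with
  | zero => simpa using hH.1
  | succ k ih => simpa [add_mul] using hH.2.1 _ ih _ ha

/-- A sparse semigroup has no two consecutive elements below its Frobenius number. -/
theorem IsSparse.succ_notMem {H : Set ℕ} {g x : ℕ} (hg : 0 < g)
    (hH : IsNumericalSemigroupOfGenus H g) (hs : IsSparse H g) (hx : x ∈ H)
    (hxF : x + 1 < gap H g) : x + 1 ∉ H := by
  classical
  intro hx1
  have hF := gap_notMem hH hg le_rfl
  have h1 : 1 ∉ H := fun h => hF (by simpa using nsmul_mem_of_genus hH h (gap H g))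
  have hx0 : x ≠ 0 := by rintro rfl; exact h1 hx1
  have hx1' : x ≠ 1 := by rintro rfl; exact h1 hx
  set k := Nat.count (fun n => n ∉ H) x with hk
  have hkpos : 0 < k := by
    have h2 : Nat.count (fun n => n ∉ H) 1 < Nat.count (fun n => n ∉ H) x :=
      Nat.count_strict_mono h1 (by omega)
    omega
  have hkg : k ≤ g - 1 := by
    rw [← count_gap hH hg le_rfl]
    exact Nat.count_monotone _ (by omega)
  have hlt : gap H k < x := Nat.nth_lt_of_lt_count (by omega)
  have hmem : gap H (k + 1) ∉ H := gap_notMem hH (by omega) (by omega)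
  have hge : x ≤ gap H (k + 1) := by
    by_contra! hcon
    have hcount := count_gap hH (Nat.add_one_pos k) (by omega)
    have := Nat.count_strict_mono (p := fun n => n ∉ H) hmem hcon
    omega
  have hne : gap H (k + 1) ≠ x := fun h => hmem (h ▸ hx)
  have hne1 : gap H (k + 1) ≠ x + 1 := fun h => hmem (h ▸ hx1)
  have := hs k hkpos hkg
  omega

open Classical in
/-- In a sparse semigroup of genus `g` with Frobenius number `F`, the single leaps together with
the positive elements below `F` number at most `g - 1`. -/
theorem card_single_add_card_le {H : Set ℕ} {g : ℕ} (hg : 0 < g)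
    (hH : IsNumericalSemigroupOfGenus H g) (hs : IsSparse H g) :
    ((Finset.range (gap H g)).filter fun x => x ∉ H ∧ x + 1 ∉ H).card +
      (((Finset.range (gap H g)).filter (· ∈ H)).erase 0).card ≤ g - 1 := by
  rw [← count_gap hH hg le_rfl, Nat.count_eq_card_filter_range]
  have hinj : Set.InjOn (fun a => a - 1)
      (((Finset.range (gap H g)).filter (· ∈ H)).erase 0 : Finset ℕ) := by
    intro a ha b hb hab
    simp only [Finset.coe_erase, Set.mem_sdiff, Set.mem_singleton_iff] at ha hb hab
    omega
  rw [← Finset.card_image_of_injOn hinj, ← Finset.card_union_of_disjoint]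
  · refine Finset.card_le_card fun x hx => ?_
    simp only [Finset.mem_union, Finset.mem_filter, Finset.mem_range, Finset.mem_image,
      Finset.mem_erase] at hx ⊢
    obtain ⟨h, h', -⟩ | ⟨a, ⟨ha0, haF, haH⟩, rfl⟩ := hx
    · exact ⟨h, h'⟩
    · obtain ⟨b, rfl⟩ := Nat.exists_eq_succ_of_ne_zero ha0
      exact ⟨by omega, fun hb => hs.succ_notMem hg hH hb haF haH⟩
  · refine Finset.disjoint_left.2 fun x hx hx' => ?_
    simp only [Finset.mem_filter, Finset.mem_image, Finset.mem_erase] at hx hx'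
    obtain ⟨a, ⟨ha0, -, haH⟩, rfl⟩ := hx'
    exact hx.2.2 (by rwa [Nat.sub_add_cancel (by omega)])

/-- **Lemma.** Let `H` be a limit sparse numerical semigroup with even Frobenius
number `ℓ_g = 2g - 2r = 6r - 2`. Then `3 ∈ H` if and only if `6r - 5 ∉ H`. -/
theorem three_nongap_iff (H : Set ℕ) (g r : ℕ) (hg : 1 < g)
    (hH : IsNumericalSemigroupOfGenus H g) (hs : IsSparse H g)
    (hlim : numSingle H g = numDouble H g)
    (hF : gap H g = 2 * g - 2 * r) (hF' : gap H g = 6 * r - 2) :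
    3 ∈ H ↔ 6 * r - 5 ∉ H := by
  classical
  have hg0 : 0 < g := by omega
  have hFH := gap_notMem hH hg0 le_rfl
  have hcons := fun x => hs.succ_notMem (x := x) hg0 hH
  have hS := card_single_add_card_le hg0 hH hs
  have hcount := count_gap hH hg0 le_rfl
  rw [Nat.count_eq_card_filter_range] at hcount
  have hpart := Finset.card_filter_add_card_filter_not (s := Finset.range (gap H g)) (· ∈ H)
  rw [Finset.card_range] at hpart
  generalize gap H g = F at *
  have hr : 0 < r := by
    by_contra h
    exact hFH (by rw [show F = 0 by omega]; exact hH.1)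
  have hsub : ∀ a b, a ∈ H → b ∉ H → a ≤ b → b - a ∉ H := fun a b ha hb hab h =>
    hb (by simpa [Nat.add_sub_cancel' hab] using hH.2.1 _ ha _ h)
  set A := (Finset.range F).filter (· ∈ H) with hA
  set S := (Finset.range F).filter fun x => x ∉ H ∧ x + 1 ∉ H with hSdef
  have h0A : 0 ∈ A := by simp [hA, hH.1]; omega
  rw [Finset.card_erase_of_mem h0A] at hS
  have hApos := Finset.card_pos.2 ⟨0, h0A⟩
  have hpred : F - 1 ∈ H := by
    by_contra h
    have : A.card ≤ S.card := by
      refine Finset.card_le_card_of_injOn (fun a => F - 1 - a) (fun a ha => ?_)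
        fun a ha b hb hab => ?_
      · simp only [hA, hSdef, Finset.coe_filter, Finset.mem_range, Set.mem_ofPred_eq] at ha ⊢
        refine ⟨by omega, hsub _ _ ha.2 h (by omega), ?_⟩
        rw [show F - 1 - a + 1 = F - a by omega]
        exact hsub _ _ ha.2 hFH ha.1.le
      · simp only [hA, Finset.coe_filter, Finset.mem_range, Set.mem_ofPred_eq] at ha hb hab
        omega
    omega
  have hpred₂ : F - 2 ∉ H := fun h =>
    hcons _ h (by omega) (by rwa [show F - 2 + 1 = F - 1 by omega])
  rw [show 6 * r - 5 = F - 3 by omega]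
  refine ⟨fun h3 => hsub _ _ h3 hFH (by omega), fun hpred₃ => ?_⟩
  have hinj : Set.InjOn (fun a => F - 3 - a) (A.erase (F - 1) : Finset ℕ) := by
    have hle : ∀ a ∈ A.erase (F - 1), a ≤ F - 4 := by
      intro a ha
      simp only [hA, Finset.mem_erase, Finset.mem_filter, Finset.mem_range] at ha
      have : a ≠ F - 2 := fun h => hpred₂ (h ▸ ha.2.2)
      have : a ≠ F - 3 := fun h => hpred₃ (h ▸ ha.2.2)
      omega
    intro a ha b hb hab
    have := hle a ha
    have := hle b hb
    simp only at hab
    omega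
  have himage : (A.erase (F - 1)).image (fun a => F - 3 - a) = S := by
    refine Finset.eq_of_subset_of_card_le (fun x hx => ?_) ?_
    · simp only [hA, hSdef, Finset.mem_image, Finset.mem_erase, Finset.mem_filter,
        Finset.mem_range] at hx ⊢
      obtain ⟨a, ⟨ha1, haF, haH⟩, rfl⟩ := hx
      have : a ≠ F - 2 := fun h => hpred₂ (h ▸ haH)
      have : a ≠ F - 3 := fun h => hpred₃ (h ▸ haH)
      refine ⟨by omega, hsub _ _ haH hpred₃ (by omega), ?_⟩
      rw [show F - 3 - a + 1 = F - 2 - a by omega]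
      exact hsub _ _ haH hpred₂ (by omega)
    · rw [Finset.card_image_of_injOn hinj, Finset.card_erase_of_mem]
      · omega
      · simp only [hA, Finset.mem_filter, Finset.mem_range]
        exact ⟨by omega, hpred⟩
  by_contra h3
  have h2 : 2 ∉ H := fun h => hFH (by
    rw [show F = (3 * r - 1) * 2 by omega]; exact nsmul_mem_of_genus hH h _)
  have h1 : 1 ∉ H := fun h => h2 (hH.2.1 1 h 1 h)
  have hmem : ∀ x, 0 < x → x ∈ S → F - 3 - x ∈ H ∧ x ≤ F - 3 := by
    intro x hx0 hx
    rw [← himage] at hx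
    simp only [hA, Finset.mem_image, Finset.mem_erase, Finset.mem_filter] at hx
    obtain ⟨a, ⟨-, -, haH⟩, rfl⟩ := hx
    exact ⟨by rwa [Nat.sub_sub_self (by omega)], by omega⟩
  obtain ⟨h4, -⟩ := hmem 1 one_pos (by simp [hSdef, h1, h2]; omega)
  obtain ⟨h5, hle⟩ := hmem 2 two_pos (by simp [hSdef, h2, h3]; omega)
  exact hcons _ h5 (by omega) (by rwa [show F - 3 - 2 + 1 = F - 3 - 1 by omega])
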